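/- In the ring A ⊗_ℚ A, where A = ℚ[x₁,x₂,x₃]/(σ₁,σ₂,σ₃), the identity 3·ρ(x₁ ⊗ x₂x₃)·ρ(x₁x₂ ⊗ x₃) = 2·ρ(x₁²x₂ ⊗ x₃²x₂) holds. -/

import Mathlib

set_option maxHeartbeats 1000000
set_option synthInstance.maxHeartbeats 400000

open MvPolynomial TensorProduct

/-- The ideal `(σ₁, σ₂, σ₃)` of elementary symmetric polynomials. -/
noncomputable abbrev symIdeal : Ideal (MvPolynomial (Fin 3) ℚ) :=
  Ideal.span {esymm (Fin 3) ℚ 1, esymm (Fin 3) ℚ 2, esymm (Fin 3) ℚ 3}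

/-- `A = ℚ[x₁,x₂,x₃]/(σ₁,σ₂,σ₃)`, the rational cohomology ring of `Fl₃(ℂ)`. -/
noncomputable abbrev FlagRing := MvPolynomial (Fin 3) ℚ ⧸ symIdeal

/-- The generators `x₁, x₂, x₃` of `A` (indexed by `Fin 3`). -/
noncomputable def xx (i : Fin 3) : FlagRing := Ideal.Quotient.mk symIdeal (X i)

lemma rename_mem_symIdeal (g : Equiv.Perm (Fin 3)) {a : MvPolynomial (Fin 3) ℚ}
    (ha : a ∈ symIdeal) : rename (⇑g) a ∈ symIdeal := by
  have h : symIdeal.map (rename (⇑g)).toRingHom ≤ symIdeal := by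
    rw [Ideal.map_span]
    refine Ideal.span_le.2 ?_
    rintro x ⟨y, hy, rfl⟩
    simp only [Set.mem_insert_iff, Set.mem_singleton_iff] at hy
    rcases hy with rfl | rfl | rfl <;>
      · show (rename (⇑g)) _ ∈ _
        rw [rename_esymm]
        apply Ideal.subset_span
        simp
  exact h (Ideal.mem_map_of_mem _ ha)

/-- The action of `ω ∈ Σ₃` on `A` by permuting the variables. -/
noncomputable def permAct (g : Equiv.Perm (Fin 3)) : FlagRing →ₐ[ℚ] FlagRing :=
  Ideal.Quotient.liftₐ symIdeal
    ((Ideal.Quotient.mkₐ ℚ symIdeal).comp (rename (⇑g)))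
    (fun a ha => by
      show Ideal.Quotient.mkₐ ℚ symIdeal (rename (⇑g) a) = 0
      rw [Ideal.Quotient.mkₐ_eq_mk]
      exact Ideal.Quotient.eq_zero_iff_mem.2 (rename_mem_symIdeal g ha))

/-- The diagonal action of `ω ∈ Σ₃` on `A ⊗_ℚ A`. -/
noncomputable def permActT (g : Equiv.Perm (Fin 3)) :
    FlagRing ⊗[ℚ] FlagRing →ₐ[ℚ] FlagRing ⊗[ℚ] FlagRing :=
  Algebra.TensorProduct.map (permAct g) (permAct g)

/-- The averaging operator `ρ(f) = (1/6) ∑_{ω ∈ Σ₃} ω·f` on `A ⊗_ℚ A`. -/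
noncomputable def avg (f : FlagRing ⊗[ℚ] FlagRing) : FlagRing ⊗[ℚ] FlagRing :=
  (6 : ℚ)⁻¹ • ∑ g : Equiv.Perm (Fin 3), permActT g f

lemma xx_sum : xx 0 + xx 1 + xx 2 = 0 := by
  have h : (esymm (Fin 3) ℚ 1) ∈ symIdeal := Ideal.subset_span (by simp)
  rw [← Ideal.Quotient.eq_zero_iff_mem, esymm_one] at h
  simpa [Fin.sum_univ_three, xx] using h

lemma xx_sum_mul : xx 0 * xx 1 + xx 0 * xx 2 + xx 1 * xx 2 = 0 := by
  have h : (esymm (Fin 3) ℚ 2) ∈ symIdeal := Ideal.subset_span (by simp)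
  have hs : Finset.powersetCard 2 (Finset.univ : Finset (Fin 3)) = {{0, 1}, {0, 2}, {1, 2}} := by
    decide
  rw [← Ideal.Quotient.eq_zero_iff_mem, esymm, hs, Finset.sum_insert (by decide),
    Finset.sum_insert (by decide), Finset.sum_singleton] at h
  simpa [xx, ← add_assoc] using h

lemma xx_prod : xx 0 * xx 1 * xx 2 = 0 := by
  have h : (esymm (Fin 3) ℚ 3) ∈ symIdeal := Ideal.subset_span (by simp)
  have hs : Finset.powersetCard 3 (Finset.univ : Finset (Fin 3)) = {Finset.univ} := by
    decide
  rw [← Ideal.Quotient.eq_zero_iff_mem, esymm, hs, Finset.sum_singleton] at h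
  simpa [xx, Fin.prod_univ_three] using h

lemma permAct_xx (g : Equiv.Perm (Fin 3)) (i : Fin 3) : permAct g (xx i) = xx (g i) := by
  change Ideal.Quotient.mk symIdeal (rename (⇑g) (X i)) = _
  rw [rename_X]
  rfl

lemma sum_perm_fin_three {M : Type*} [AddCommMonoid M] (F : Fin 3 → Fin 3 → Fin 3 → M) :
    ∑ g : Equiv.Perm (Fin 3), F (g 0) (g 1) (g 2) =
      F 0 1 2 + F 0 2 1 + F 1 0 2 + F 1 2 0 + F 2 0 1 + F 2 1 0 := by
  have hs : (Finset.univ : Finset (Equiv.Perm (Fin 3))) =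
      {1, Equiv.swap 1 2, Equiv.swap 0 1, Equiv.swap 0 1 * Equiv.swap 1 2,
        Equiv.swap 0 2 * Equiv.swap 1 2, Equiv.swap 0 2} := by
    decide
  rw [hs, Finset.sum_insert (by decide), Finset.sum_insert (by decide),
    Finset.sum_insert (by decide), Finset.sum_insert (by decide), Finset.sum_insert (by decide),
    Finset.sum_singleton]
  simp only [← add_assoc]
  rfl

/-- If the elementary symmetric functions of three elements vanish, then so do their cubes, and
the monomials `xᵢ² xⱼ` agree up to sign. -/
lemma sq_mul_eq_of_esymm_eq_zero {R : Type*} [CommRing R] {x y z : R} (h₁ : x + y + z = 0)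
    (h₂ : x * y + x * z + y * z = 0) (h₃ : x * y * z = 0) :
    x * y = z ^ 2 ∧ x * z = y ^ 2 ∧ y * z = x ^ 2 ∧ x ^ 3 = 0 ∧ y ^ 3 = 0 ∧ z ^ 3 = 0 ∧
      x ^ 2 * z = -(x ^ 2 * y) ∧ y ^ 2 * x = -(x ^ 2 * y) ∧ y ^ 2 * z = x ^ 2 * y ∧
      z ^ 2 * x = x ^ 2 * y ∧ z ^ 2 * y = -(x ^ 2 * y) := by
  obtain rfl : z = -x - y := by linear_combination h₁
  refine ⟨?_, ?_, ?_, ?_, ?_, ?_, ?_, ?_, ?_, ?_, ?_⟩ <;> grind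

lemma three_smul_mul_smul_eq_two_smul {R : Type*} [CommRing R] [Algebra ℚ R] {s t u : R}
    (h : s * t = 4 * u) : 3 * ((6 : ℚ)⁻¹ • s) * ((6 : ℚ)⁻¹ • t) = 2 * ((6 : ℚ)⁻¹ • u) := by
  have h6 : (6 : R) * algebraMap ℚ R 6⁻¹ = 1 := by
    rw [← map_ofNat (algebraMap ℚ R) 6, ← map_mul]
    norm_num
  simp only [Algebra.smul_def]
  linear_combination 3 * algebraMap ℚ R 6⁻¹ ^ 2 * h + 2 * algebraMap ℚ R 6⁻¹ * u * h6

/-- In `A ⊗_ℚ A`, `3·ρ(x₁ ⊗ x₂x₃)·ρ(x₁x₂ ⊗ x₃) = 2·ρ(x₁²x₂ ⊗ x₃²x₂)`. -/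
theorem three_avg_mul_avg_eq_two_avg :
    (3 : FlagRing ⊗[ℚ] FlagRing) * avg (xx 0 ⊗ₜ[ℚ] (xx 1 * xx 2)) *
        avg ((xx 0 * xx 1) ⊗ₜ[ℚ] xx 2) =
      (2 : FlagRing ⊗[ℚ] FlagRing) * avg ((xx 0 ^ 2 * xx 1) ⊗ₜ[ℚ] (xx 2 ^ 2 * xx 1)) := by
  obtain ⟨hxy, hxz, hyz, hx, hy, hz, h02, h10, h12, h20, h21⟩ :=
    sq_mul_eq_of_esymm_eq_zero xx_sum xx_sum_mul xx_prod
  simp only [avg, permActT, Algebra.TensorProduct.map_tmul, map_mul, map_pow, permAct_xx]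
  rw [sum_perm_fin_three fun i j k => xx i ⊗ₜ[ℚ] (xx j * xx k),
    sum_perm_fin_three fun i j k => (xx i * xx j) ⊗ₜ[ℚ] xx k,
    sum_perm_fin_three fun i j k => (xx i ^ 2 * xx j) ⊗ₜ[ℚ] (xx k ^ 2 * xx j)]
  refine three_smul_mul_smul_eq_two_smul (R := FlagRing ⊗[ℚ] FlagRing) ?_
  simp only [mul_comm (xx 1) (xx 0), mul_comm (xx 2) (xx 0), mul_comm (xx 2) (xx 1), hxy, hxz, hyz,
    mul_add, add_mul, Algebra.TensorProduct.tmul_mul_tmul,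
    ← pow_succ, mul_comm (xx _) (xx _ ^ 2), Nat.reduceAdd, hx, hy, hz,
    h02, h10, h12, h20, h21, tmul_neg, neg_tmul, tmul_zero]
  ring
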